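/- Let Γ : G → R be a partial projective representation with factor set σ, and for g ∈ G define e_g = σ(g⁻¹,g)⁻¹ Γ(g)Γ(g⁻¹) if σ(g⁻¹,g) ≠ 0 and e_g = 0 otherwise. Then each e_g is idempotent, the e_g pairwise commute, and Γ(g)e_h = e_{gh}Γ(g) and e_hΓ(g) = Γ(g)e_{g⁻¹h} for all g, h ∈ G. -/

import Mathlib

open scoped Classical

/-- Let `Γ : G → R` be a partial projective representation with factor
set `σ`, and for `g ∈ G` set `e g = σ(g⁻¹,g)⁻¹ • Γ(g)Γ(g⁻¹)` if `σ(g⁻¹,g) ≠ 0`, and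
`e g = 0` otherwise.  Then each `e g` is idempotent, they pairwise commute, and
`Γ(g) e h = e (gh) Γ(g)` and `e h Γ(g) = Γ(g) e (g⁻¹h)` for all `g, h ∈ G`. -/
theorem partialProjRep_idempotents
    {κ G R : Type*} [Field κ] [Group G] [Ring R] [Algebra κ R]
    (Γ : G → R) (σ : G → G → κ)
    (h1 : ∀ g h : G, σ g h = 0 → Γ g⁻¹ * Γ (g * h) = 0 ∧ Γ (g * h) * Γ h⁻¹ = 0)
    (h2 : ∀ g h : G, Γ g⁻¹ * Γ g * Γ h = σ g h • (Γ g⁻¹ * Γ (g * h)))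
    (h3 : ∀ g h : G, Γ g * Γ h * Γ h⁻¹ = σ g h • (Γ (g * h) * Γ h⁻¹))
    (h4 : Γ 1 = 1)
    (hfac : ∀ g h : G, Γ g * Γ h = 0 → σ g h = 0)
    (e : G → R)
    (he : ∀ g : G, e g = if σ g⁻¹ g = 0 then 0 else (σ g⁻¹ g)⁻¹ • (Γ g * Γ g⁻¹)) :
    (∀ g : G, e g * e g = e g) ∧
    (∀ g h : G, e g * e h = e h * e g) ∧
    (∀ g h : G, Γ g * e h = e (g * h) * Γ g) ∧
    (∀ g h : G, e h * Γ g = Γ g * e (g⁻¹ * h)) := by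
  have he' : ∀ g, e g = (σ g⁻¹ g)⁻¹ • (Γ g * Γ g⁻¹) := by
    intro g
    rw [he]
    split_ifs with h
    · simp [h]
    · rfl
  have z1 : ∀ g, σ g⁻¹ g = 0 → Γ g = 0 := by
    intro g h
    have := (h1 _ _ h).1
    simpa [h4] using this
  have z2 : ∀ g, σ g⁻¹ g = 0 → Γ g⁻¹ = 0 := by
    intro g h
    have := (h1 _ _ h).2
    simpa [h4] using this
  -- Γ g⁻¹ Γ g Γ g⁻¹ = s • Γ g⁻¹
  have t2 : ∀ g, Γ g⁻¹ * Γ g * Γ g⁻¹ = σ g⁻¹ g • Γ g⁻¹ := by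
    intro g
    have := h3 g⁻¹ g
    simpa [h4] using this
  have t1 : ∀ g, Γ g * Γ g⁻¹ * Γ g = σ g⁻¹ g • Γ g := by
    intro g
    have := h2 g⁻¹ g
    simpa [h4] using this
  have key : ∀ g h : G, Γ g * e h = e (g * h) * Γ g := by
    intro g h
    have L : Γ g * Γ h * Γ h⁻¹ = σ g h • (Γ (g * h) * Γ h⁻¹) := h3 g h
    have M : Γ (g * h) * Γ (g * h)⁻¹ * Γ g = σ (g * h)⁻¹ g • (Γ (g * h) * Γ h⁻¹) := by
      have := h2 (g * h)⁻¹ g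
      simpa using this
    have C : (σ g h * σ (g * h)⁻¹ (g * h)) • (Γ (g * h) * Γ h⁻¹)
        = (σ (g * h)⁻¹ g * σ h⁻¹ h) • (Γ (g * h) * Γ h⁻¹) := by
      calc _ = Γ (g * h) * Γ (g * h)⁻¹ * (Γ g * Γ h * Γ h⁻¹) := by
            rw [L, mul_smul_comm, ← mul_assoc, t1, smul_mul_assoc, smul_smul]
        _ = (Γ (g * h) * Γ (g * h)⁻¹ * Γ g) * (Γ h * Γ h⁻¹) := by simp only [mul_assoc]
        _ = _ := by
            rw [M, smul_mul_assoc, mul_assoc, ← mul_assoc (Γ h⁻¹), t2, mul_smul_comm, smul_smul]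
    rw [he', he', mul_smul_comm, smul_mul_assoc, ← mul_assoc, L, M, smul_smul, smul_smul]
    by_cases a : σ h⁻¹ h = 0
    · simp [z2 h a]
    by_cases b : σ (g * h)⁻¹ (g * h) = 0
    · simp [z1 _ b]
    have := congrArg (fun x => ((σ h⁻¹ h)⁻¹ * (σ (g * h)⁻¹ (g * h))⁻¹) • x) C
    simp only [smul_smul] at this
    convert this using 2
    · field_simp
    · field_simp
  have key2 : ∀ g h : G, e h * Γ g = Γ g * e (g⁻¹ * h) := by
    intro g h
    rw [key, mul_inv_cancel_left]
  refine ⟨?_, ?_, key, key2⟩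
  · intro g
    by_cases a : σ g⁻¹ g = 0
    · simp [he', a]
    rw [he', smul_mul_smul_comm, ← mul_assoc, t1, smul_mul_assoc, smul_smul]
    congr 1
    field_simp
  · intro g h
    rw [he' g, smul_mul_assoc, mul_smul_comm, mul_assoc, key, ← mul_assoc, key, ← mul_assoc,
      mul_inv_cancel, one_mul, mul_assoc]
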